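/- Let n ≥ 3 be an integer, ε > 0 and a ∈ ℝ^{n-1}. Then the Euclidean energy functional evaluated at the standard bubble equals E(U_{ε,a}) = (1/(2(n-1))) K_n^{-2(n-1)}, independently of ε and a. -/

import Mathlib

open MeasureTheory Real

/-- The last coordinate `y_n` of a point `y ∈ ℝ^n`. -/
noncomputable def lastCoord (n : ℕ) (y : EuclideanSpace ℝ (Fin n)) : ℝ :=
  if h : 0 < n then y ⟨n - 1, Nat.sub_lt h one_pos⟩ else 0

/-- The embedding `ℝ^{n-1} × ℝ → ℝ^n`, `(x, t) ↦ (x, t)`. -/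
noncomputable def emb (n : ℕ) (x : EuclideanSpace ℝ (Fin (n - 1))) (t : ℝ) :
    EuclideanSpace ℝ (Fin n) :=
  (EuclideanSpace.equiv (Fin n) ℝ).symm
    (fun i => if h : (i : ℕ) < n - 1 then x ⟨i, h⟩ else t)

/-- The area `σ_{n-1}` of the unit `(n-1)`-sphere in `ℝ^n`. -/
noncomputable def sphereArea (n : ℕ) : ℝ :=
  n * (volume (Metric.ball (0 : EuclideanSpace ℝ (Fin n)) 1)).toReal

/-- The sharp Sobolev trace constant `K_n`. -/
noncomputable def Kconst (n : ℕ) : ℝ :=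
  (((n : ℝ) - 2) / 2) ^ (-(1 : ℝ) / 2) * sphereArea n ^ (-(1 : ℝ) / (2 * ((n : ℝ) - 1)))

/-- The standard bubble `U_{ε,a}`. -/
noncomputable def bubble (n : ℕ) (ε : ℝ) (a : EuclideanSpace ℝ (Fin (n - 1)))
    (y : EuclideanSpace ℝ (Fin n)) : ℝ :=
  (ε / ((lastCoord n y + ε / ((n : ℝ) - 2)) ^ 2 +
      ∑ i : Fin (n - 1), (y (Fin.castLE (Nat.sub_le n 1) i) - a i) ^ 2)) ^ (((n : ℝ) - 2) / 2)

/-- The Euclidean Laplacian `Δu(y) = ∑ ∂²u/∂y_i²(y)`. -/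
noncomputable def lap (n : ℕ) (u : EuclideanSpace ℝ (Fin n) → ℝ)
    (y : EuclideanSpace ℝ (Fin n)) : ℝ :=
  ∑ i : Fin n, iteratedDeriv 2 (fun t : ℝ => u (y + t • EuclideanSpace.single i (1 : ℝ))) 0


theorem rpow_mul_exp_neg_mul_add_sq (q s r u : ℝ) :
    u ^ q * rexp (-((s ^ 2 + r ^ 2) * u)) =
      (u ^ q * rexp (-(s ^ 2 * u))) * rexp (-u * r ^ 2) := by
  rw [mul_assoc, ← Real.exp_add]; ring_nf

section InnerProductSpace

variable {V : Type*} [NormedAddCommGroup V] [InnerProductSpace ℝ V] [FiniteDimensional ℝ V]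
  [MeasurableSpace V] [BorelSpace V]

theorem integrable_rexp_neg_mul_sq_norm {b : ℝ} (hb : 0 < b) :
    Integrable fun v : V => rexp (-b * ‖v‖ ^ 2) := by
  refine Integrable.of_integral_ne_zero ?_
  rw [GaussianFourier.integral_rexp_neg_mul_sq_norm hb]
  positivity

theorem integrable_rpow_mul_exp_neg_mul_add_sq_norm {p s : ℝ}
    (hp : (Module.finrank ℝ V : ℝ) / 2 < p) (hs : 0 < s) :
    Integrable (fun z : V × ℝ => z.2 ^ (p - 1) * rexp (-((s ^ 2 + ‖z.1‖ ^ 2) * z.2)))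
      ((volume : Measure V).prod (volume.restrict (Set.Ioi (0 : ℝ)))) := by
  have hmeas : Measurable fun z : V × ℝ =>
      z.2 ^ (p - 1) * rexp (-((s ^ 2 + ‖z.1‖ ^ 2) * z.2)) := by fun_prop
  refine (integrable_prod_iff' hmeas.aestronglyMeasurable).2 ⟨?_, ?_⟩
  · filter_upwards [ae_restrict_mem measurableSet_Ioi] with u hu
    simp only [rpow_mul_exp_neg_mul_add_sq]
    exact (integrable_rexp_neg_mul_sq_norm hu).const_mul _
  · have hq : -1 < p - Module.finrank ℝ V / 2 - 1 := by linarith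
    have := (integrableOn_rpow_mul_exp_neg_mul_rpow hq one_pos (pow_pos hs 2)).const_mul
      (π ^ (Module.finrank ℝ V / 2 : ℝ))
    refine IntegrableOn.congr_fun this (fun u hu => ?_) measurableSet_Ioi
    have hu : 0 < u := hu
    have hnn (x : V) : ‖u ^ (p - 1) * rexp (-((s ^ 2 + ‖x‖ ^ 2) * u))‖ =
        (u ^ (p - 1) * rexp (-(s ^ 2 * u))) * rexp (-u * ‖x‖ ^ 2) := by
      rw [Real.norm_of_nonneg (by positivity), rpow_mul_exp_neg_mul_add_sq]
    simp only [hnn]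
    rw [integral_const_mul, GaussianFourier.integral_rexp_neg_mul_sq_norm hu,
      div_rpow pi_pos.le hu.le, rpow_one, neg_mul,
      show p - Module.finrank ℝ V / 2 - 1 = (p - 1) - Module.finrank ℝ V / 2 by ring,
      rpow_sub hu]
    ring

theorem integrable_add_sq_norm_rpow_neg {p s : ℝ}
    (hp : (Module.finrank ℝ V : ℝ) / 2 < p) (hs : 0 < s) :
    Integrable fun x : V => (s ^ 2 + ‖x‖ ^ 2) ^ (-p) := by
  have hp0 : 0 < p := lt_of_le_of_lt (by positivity) hp
  refine ((integrable_rpow_mul_exp_neg_mul_add_sq_norm hp hs).integral_prod_left.div_const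
    (Gamma p)).congr (.of_forall fun x => ?_)
  have hr : 0 < s ^ 2 + ‖x‖ ^ 2 := by positivity
  have hG := (Gamma_pos_of_pos hp0).ne'
  simp only
  rw [integral_rpow_mul_exp_neg_mul_Ioi hp0 hr, mul_div_assoc, div_self hG, one_div,
    inv_rpow hr.le, rpow_neg hr.le, mul_one]

theorem integral_add_sq_norm_rpow_neg {p s : ℝ}
    (hp : (Module.finrank ℝ V : ℝ) / 2 < p) (hs : 0 < s) :
    ∫ x : V, (s ^ 2 + ‖x‖ ^ 2) ^ (-p) =
      π ^ (Module.finrank ℝ V / 2 : ℝ) * Gamma (p - Module.finrank ℝ V / 2) / Gamma p *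
        s ^ (Module.finrank ℝ V - 2 * p) := by
  have hp0 : 0 < p := lt_of_le_of_lt (by positivity) hp
  have hG := (Gamma_pos_of_pos hp0).ne'
  have hswap := integral_integral_swap
    (f := fun (x : V) (u : ℝ) => u ^ (p - 1) * rexp (-((s ^ 2 + ‖x‖ ^ 2) * u)))
    (integrable_rpow_mul_exp_neg_mul_add_sq_norm (V := V) hp hs)
  have hleft (x : V) : ∫ u in Set.Ioi (0 : ℝ), u ^ (p - 1) * rexp (-((s ^ 2 + ‖x‖ ^ 2) * u)) =
      (s ^ 2 + ‖x‖ ^ 2) ^ (-p) * Gamma p := by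
    have hr : 0 < s ^ 2 + ‖x‖ ^ 2 := by positivity
    rw [integral_rpow_mul_exp_neg_mul_Ioi hp0 hr, one_div, inv_rpow hr.le, rpow_neg hr.le]
  have hright : ∀ u ∈ Set.Ioi (0 : ℝ),
      ∫ x : V, u ^ (p - 1) * rexp (-((s ^ 2 + ‖x‖ ^ 2) * u)) =
        π ^ (Module.finrank ℝ V / 2 : ℝ) *
          (u ^ (p - Module.finrank ℝ V / 2 - 1) * rexp (-(s ^ 2 * u))) := by
    intro u hu
    have hu : 0 < u := hu
    simp only [rpow_mul_exp_neg_mul_add_sq]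
    rw [integral_const_mul, GaussianFourier.integral_rexp_neg_mul_sq_norm hu,
      div_rpow pi_pos.le hu.le,
      show p - Module.finrank ℝ V / 2 - 1 = (p - 1) - Module.finrank ℝ V / 2 by ring,
      rpow_sub hu (p - 1)]
    ring
  simp only [hleft] at hswap
  rw [setIntegral_congr_fun measurableSet_Ioi hright, integral_mul_const, integral_const_mul,
    integral_rpow_mul_exp_neg_mul_Ioi (by linarith) (by positivity), one_div,
    inv_rpow (by positivity), ← rpow_neg (by positivity)] at hswap
  have hpow : (s ^ 2) ^ (-(p - Module.finrank ℝ V / 2)) = s ^ (Module.finrank ℝ V - 2 * p) := by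
    rw [← rpow_natCast s 2, ← rpow_mul hs.le]
    push_cast
    ring_nf
  rw [eq_div_of_mul_eq hG hswap, hpow]
  ring

end InnerProductSpace

/-- The splitting `y ↦ (y_n, ȳ)` of `ℝ^{k+1}` as a measurable equivalence. -/
noncomputable def lastInitEquiv (k : ℕ) :
    EuclideanSpace ℝ (Fin (k + 1)) ≃ᵐ ℝ × EuclideanSpace ℝ (Fin k) :=
  (MeasurableEquiv.toLp 2 (Fin (k + 1) → ℝ)).symm.trans
    ((MeasurableEquiv.piFinSuccAbove (fun _ => ℝ) (Fin.last k)).trans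
      ((MeasurableEquiv.refl ℝ).prodCongr (MeasurableEquiv.toLp 2 (Fin k → ℝ))))

theorem measurePreserving_lastInitEquiv (k : ℕ) : MeasurePreserving (lastInitEquiv k) :=
  ((MeasurePreserving.id volume).prod (PiLp.volume_preserving_toLp (Fin k))).comp
    ((volume_preserving_piFinSuccAbove (fun _ => ℝ) (Fin.last k)).comp
      (PiLp.volume_preserving_ofLp (Fin (k + 1))))

theorem lastInitEquiv_fst (k : ℕ) (y : EuclideanSpace ℝ (Fin (k + 1))) :
    (lastInitEquiv k y).1 = lastCoord (k + 1) y := by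
  simp only [lastCoord, k.succ_pos, dif_pos]
  rfl

theorem lastInitEquiv_snd_apply (k : ℕ) (y : EuclideanSpace ℝ (Fin (k + 1))) (i : Fin k) :
    (lastInitEquiv k y).2 i = y i.castSucc := by
  simp only [lastInitEquiv, MeasurableEquiv.trans_apply]
  exact congrArg y (Fin.succAbove_last_apply i)

theorem lastCoord_emb {k : ℕ} (x : EuclideanSpace ℝ (Fin k)) (t : ℝ) :
    lastCoord (k + 1) (emb (k + 1) x t) = t := by
  simp [lastCoord, emb]

theorem emb_castSucc {k : ℕ} (x : EuclideanSpace ℝ (Fin k)) (t : ℝ) (i : Fin k) :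
    emb (k + 1) x t i.castSucc = x i := by
  simp [emb]

theorem sq_norm_sub_emb {k : ℕ} (y : EuclideanSpace ℝ (Fin (k + 1)))
    (a : EuclideanSpace ℝ (Fin k)) (t : ℝ) :
    ‖y - emb (k + 1) a t‖ ^ 2 =
      (lastCoord (k + 1) y - t) ^ 2 + ‖(lastInitEquiv k y).2 - a‖ ^ 2 := by
  have hl : emb (k + 1) a t (Fin.last k) = t := by simp [emb]
  have hy : lastCoord (k + 1) y = y (Fin.last k) := by simp [lastCoord, Fin.last]
  rw [EuclideanSpace.real_norm_sq_eq, EuclideanSpace.real_norm_sq_eq, Fin.sum_univ_castSucc]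
  simp only [PiLp.sub_apply, hl, emb_castSucc, hy, lastInitEquiv_snd_apply]
  ring

theorem bubble_eq_norm {k : ℕ} (ε : ℝ) (a : EuclideanSpace ℝ (Fin k))
    (y : EuclideanSpace ℝ (Fin (k + 1))) :
    bubble (k + 1) ε a y =
      (ε / ‖y - emb (k + 1) a (-(ε / ((k : ℝ) - 1)))‖ ^ 2) ^ (((k : ℝ) - 1) / 2) := by
  rw [sq_norm_sub_emb, EuclideanSpace.real_norm_sq_eq, bubble]
  simp only [PiLp.sub_apply, lastInitEquiv_snd_apply, sub_neg_eq_add]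
  rw [show ((k + 1 : ℕ) : ℝ) - 2 = k - 1 by push_cast; ring]
  rfl

theorem sq_norm_gradient_div_sq_norm_rpow {F : Type*} [NormedAddCommGroup F]
    [InnerProductSpace ℝ F] [CompleteSpace F] {ε : ℝ} (hε : 0 < ε) (p : ℝ) {c y : F}
    (hy : y ≠ c) :
    ‖gradient (fun z => (ε / ‖z - c‖ ^ 2) ^ p) y‖ ^ 2 =
      ε ^ (2 * p) * (2 * p) ^ 2 * (‖y - c‖ ^ 2) ^ (-(2 * p + 1)) := by
  have hq : 0 < ‖y - c‖ ^ 2 := by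
    have := norm_pos_iff.2 (sub_ne_zero.2 hy)
    positivity
  have hfun : (fun z => (ε / ‖z - c‖ ^ 2) ^ p) = fun z => ε ^ p * (‖z - c‖ ^ 2) ^ (-p) := by
    funext z
    rw [div_rpow hε.le (by positivity), rpow_neg (by positivity), div_eq_mul_inv]
  have hgrad : HasGradientAt (fun z => ε ^ p * (‖z - c‖ ^ 2) ^ (-p))
      ((ε ^ p * (-p * (‖y - c‖ ^ 2) ^ (-p - 1)) * 2) • (y - c)) y := by
    rw [hasGradientAt_iff_hasFDerivAt]
    have h := (((hasFDerivAt_id y).sub_const c).norm_sq.rpow_const (p := -p)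
      (Or.inl hq.ne')).const_mul (ε ^ p)
    convert! h using 1
    ext v
    simp
    ring
  rw [hfun, hgrad.gradient, norm_smul, mul_pow, Real.norm_eq_abs, sq_abs,
    show -(2 * p + 1) = (-p - 1) + (-p - 1) + 1 by ring, rpow_add hq, rpow_add hq, rpow_one,
    two_mul p, rpow_add hε]
  ring

theorem integral_Ioi_add_rpow_of_lt {p s : ℝ} (hp : p < -1) (hs : 0 < s) :
    ∫ t in Set.Ioi (0 : ℝ), (t + s) ^ p = -s ^ (p + 1) / (p + 1) := by
  rw [← integral_Ioi_rpow_of_lt hp hs,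
    ← (measurePreserving_add_right volume s).setIntegral_preimage_emb
      (measurableEmbedding_addRight s) (fun t => t ^ p) (Set.Ioi s)]
  simp

theorem integral_halfSpace_sq_norm_sub_emb_rpow_neg {k : ℕ} (hk : 2 ≤ k) {s : ℝ} (hs : 0 < s)
    (a : EuclideanSpace ℝ (Fin k)) :
    ∫ y in {y : EuclideanSpace ℝ (Fin (k + 1)) | 0 < lastCoord (k + 1) y},
        (‖y - emb (k + 1) a (-s)‖ ^ 2) ^ (-(k : ℝ)) =
      π ^ (k / 2 : ℝ) * Gamma (k / 2) / Gamma k * s ^ (1 - k : ℝ) / (k - 1) := by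
  have hk' : (2 : ℝ) ≤ k := by exact_mod_cast hk
  have hfr : (Module.finrank ℝ (EuclideanSpace ℝ (Fin k)) : ℝ) / 2 < k := by simp; linarith
  set G : ℝ × EuclideanSpace ℝ (Fin k) → ℝ :=
    fun z => ((z.1 + s) ^ 2 + ‖z.2 - a‖ ^ 2) ^ (-(k : ℝ)) with hG
  have hset : {y : EuclideanSpace ℝ (Fin (k + 1)) | 0 < lastCoord (k + 1) y} =
      lastInitEquiv k ⁻¹' (Set.Ioi 0 ×ˢ Set.univ) := by
    ext y; simp [lastInitEquiv_fst]
  have hfun (y : EuclideanSpace ℝ (Fin (k + 1))) :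
      (‖y - emb (k + 1) a (-s)‖ ^ 2) ^ (-(k : ℝ)) = G (lastInitEquiv k y) := by
    simp only [sq_norm_sub_emb, hG, lastInitEquiv_fst, sub_neg_eq_add]
  have hslice : ∀ t ∈ Set.Ioi (0 : ℝ), ∫ x, G (t, x) =
      π ^ (k / 2 : ℝ) * Gamma (k / 2) / Gamma k * (t + s) ^ (-(k : ℝ)) := by
    intro t ht
    have hts : 0 < t + s := add_pos ht hs
    rw [hG, integral_sub_right_eq_self (fun x => ((t + s) ^ 2 + ‖x‖ ^ 2) ^ (-(k : ℝ))) a,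
      integral_add_sq_norm_rpow_neg hfr hts, finrank_euclideanSpace_fin]
    ring_nf
  have hint : IntegrableOn G (Set.Ioi 0 ×ˢ Set.univ) (volume.prod volume) := by
    have hmeas : Measurable G := by fun_prop
    rw [IntegrableOn, ← Measure.prod_restrict, Measure.restrict_univ,
      integrable_prod_iff hmeas.aestronglyMeasurable]
    have hnorm (z) : ‖G z‖ = G z := Real.norm_of_nonneg (by positivity)
    refine ⟨?_, ?_⟩
    · filter_upwards [ae_restrict_mem measurableSet_Ioi] with t ht
      exact (integrable_add_sq_norm_rpow_neg hfr (add_pos ht hs)).comp_sub_right a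
    · simp only [hnorm]
      exact IntegrableOn.congr_fun ((integrableOn_add_rpow_Ioi_of_lt (by linarith)
        (by linarith)).const_mul _) (fun t ht => (hslice t ht).symm) measurableSet_Ioi
  rw [hset]
  simp only [hfun]
  rw [(measurePreserving_lastInitEquiv k).setIntegral_preimage_emb
    (lastInitEquiv k).measurableEmbedding, Measure.volume_eq_prod, setIntegral_prod _ hint,
    Measure.restrict_univ, setIntegral_congr_fun measurableSet_Ioi hslice, integral_const_mul,
    integral_Ioi_add_rpow_of_lt (by linarith) hs,
    show -(k : ℝ) + 1 = 1 - k by ring, neg_div, ← div_neg, neg_sub, ← mul_div_assoc]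

theorem sphereArea_succ (k : ℕ) :
    sphereArea (k + 1) = 2 * π ^ ((k + 1) / 2 : ℝ) / Gamma ((k + 1) / 2) := by
  have hpos : (0 : ℝ) < ((k + 1 : ℕ) : ℝ) / 2 := by positivity
  have hG := (Gamma_pos_of_pos hpos).ne'
  rw [sphereArea, EuclideanSpace.volume_ball, ENNReal.ofReal_one, one_pow, one_mul,
    ENNReal.toReal_ofReal (by positivity), Fintype.card_fin, Gamma_add_one hpos.ne',
    sqrt_eq_rpow, ← rpow_natCast, ← rpow_mul pi_pos.le]
  push_cast at hG ⊢
  rw [one_div_mul_eq_div]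
  field_simp

theorem pi_rpow_mul_Gamma_div_Gamma {k : ℕ} (hk : 0 < k) :
    π ^ (k / 2 : ℝ) * Gamma (k / 2) / Gamma k = 2 ^ (-(k : ℝ)) * sphereArea (k + 1) := by
  have hk' : (0 : ℝ) < k := by exact_mod_cast hk
  have hdup := Gamma_mul_Gamma_add_half_of_pos (half_pos hk')
  have h1 := (Gamma_pos_of_pos hk').ne'
  have h2 := (Gamma_pos_of_pos (show (0 : ℝ) < (k + 1) / 2 by positivity)).ne'
  rw [← add_div, mul_div_cancel₀ _ two_ne_zero, sqrt_eq_rpow, sub_eq_add_neg,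
    rpow_add two_pos, rpow_one] at hdup
  rw [sphereArea_succ, ← mul_div_assoc, div_eq_div_iff h1 h2, mul_assoc, hdup, add_div,
    rpow_add pi_pos]
  ring

theorem Kconst_rpow_neg {n : ℕ} (hn : 3 ≤ n) :
    Kconst n ^ (-(2 : ℝ) * ((n : ℝ) - 1)) =
      (((n : ℝ) - 2) / 2) ^ ((n : ℝ) - 1) * sphereArea n := by
  have hn' : (3 : ℝ) ≤ n := by exact_mod_cast hn
  have h1 : 0 ≤ ((n : ℝ) - 2) / 2 := by linarith
  have h2 : 0 ≤ sphereArea n := by unfold sphereArea; positivity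
  have h3 : (n : ℝ) - 1 ≠ 0 := by linarith
  rw [Kconst, mul_rpow (by positivity) (by positivity), ← rpow_mul h1, ← rpow_mul h2,
    show -(1 : ℝ) / 2 * (-2 * ((n : ℝ) - 1)) = n - 1 by ring,
    show -(1 : ℝ) / (2 * ((n : ℝ) - 1)) * (-2 * ((n : ℝ) - 1)) = 1 by field_simp, rpow_one]

theorem integral_sq_norm_gradient_bubble {k : ℕ} (hk : 2 ≤ k) {ε : ℝ} (hε : 0 < ε)
    (a : EuclideanSpace ℝ (Fin k)) :
    ∫ y in {y : EuclideanSpace ℝ (Fin (k + 1)) | 0 < lastCoord (k + 1) y},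
        ‖gradient (bubble (k + 1) ε a) y‖ ^ 2 =
      (((k : ℝ) - 1) / 2) ^ (k : ℝ) * sphereArea (k + 1) := by
  have hk' : (2 : ℝ) ≤ k := by exact_mod_cast hk
  have hk1 : (0 : ℝ) < k - 1 := by linarith
  have hs : 0 < ε / ((k : ℝ) - 1) := div_pos hε hk1
  have hmeas : MeasurableSet {y : EuclideanSpace ℝ (Fin (k + 1)) | 0 < lastCoord (k + 1) y} := by
    simp only [← lastInitEquiv_fst]
    exact measurableSet_lt measurable_const (lastInitEquiv k).measurable.fst
  have hgrad : ∀ y ∈ {y : EuclideanSpace ℝ (Fin (k + 1)) | 0 < lastCoord (k + 1) y},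
      ‖gradient (bubble (k + 1) ε a) y‖ ^ 2 = ε ^ ((k : ℝ) - 1) * ((k : ℝ) - 1) ^ 2 *
        (‖y - emb (k + 1) a (-(ε / ((k : ℝ) - 1)))‖ ^ 2) ^ (-(k : ℝ)) := by
    intro y hy
    have hne : y ≠ emb (k + 1) a (-(ε / ((k : ℝ) - 1))) := by
      rintro rfl
      change 0 < lastCoord (k + 1) _ at hy
      rw [lastCoord_emb] at hy
      linarith
    rw [funext (bubble_eq_norm ε a), sq_norm_gradient_div_sq_norm_rpow hε _ hne,
      mul_div_cancel₀ _ two_ne_zero, sub_add_cancel]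
  rw [setIntegral_congr_fun hmeas hgrad, integral_const_mul,
    integral_halfSpace_sq_norm_sub_emb_rpow_neg hk hs,
    pi_rpow_mul_Gamma_div_Gamma (by omega), show (1 - k : ℝ) = -(k - 1) by ring,
    rpow_neg hs.le, div_rpow hε.le hk1.le, div_rpow hk1.le two_pos.le, rpow_neg two_pos.le]
  have hε' := (rpow_pos_of_pos hε ((k : ℝ) - 1)).ne'
  rw [show ((k : ℝ) - 1) ^ (k : ℝ) = (k - 1) ^ ((k : ℝ) - 1) * (k - 1) by
    rw [← rpow_add_one hk1.ne', sub_add_cancel]]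
  field_simp

theorem integral_abs_bubble_rpow {k : ℕ} (hk : 2 ≤ k) {ε : ℝ} (hε : 0 < ε)
    (a : EuclideanSpace ℝ (Fin k)) :
    ∫ x : EuclideanSpace ℝ (Fin k),
        |bubble (k + 1) ε a (emb (k + 1) x 0)| ^ (2 * (k : ℝ) / ((k : ℝ) - 1)) =
      (((k : ℝ) - 1) / 2) ^ (k : ℝ) * sphereArea (k + 1) := by
  have hk' : (2 : ℝ) ≤ k := by exact_mod_cast hk
  have hk1 : (0 : ℝ) < k - 1 := by linarith
  have hs : 0 < ε / ((k : ℝ) - 1) := div_pos hε hk1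
  have hfr : (Module.finrank ℝ (EuclideanSpace ℝ (Fin k)) : ℝ) / 2 < k := by simp; linarith
  have hbd (x : EuclideanSpace ℝ (Fin k)) :
      |bubble (k + 1) ε a (emb (k + 1) x 0)| ^ (2 * (k : ℝ) / ((k : ℝ) - 1)) =
        ε ^ (k : ℝ) * ((ε / ((k : ℝ) - 1)) ^ 2 + ‖x - a‖ ^ 2) ^ (-(k : ℝ)) := by
    have hx : (lastInitEquiv k (emb (k + 1) x 0)).2 = x := by
      ext i; rw [lastInitEquiv_snd_apply, emb_castSucc]
    rw [bubble_eq_norm, abs_of_nonneg (by positivity), ← rpow_mul (by positivity),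
      show ((k : ℝ) - 1) / 2 * (2 * k / (k - 1)) = k by field_simp, sq_norm_sub_emb,
      lastCoord_emb, hx, zero_sub, neg_neg, div_rpow hε.le (by positivity),
      rpow_neg (by positivity), div_eq_mul_inv]
  simp only [hbd]
  rw [integral_const_mul, integral_sub_right_eq_self
      (fun x => ((ε / ((k : ℝ) - 1)) ^ 2 + ‖x‖ ^ 2) ^ (-(k : ℝ))) a,
    integral_add_sq_norm_rpow_neg hfr hs, finrank_euclideanSpace_fin,
    show (k : ℝ) - k / 2 = k / 2 by ring, pi_rpow_mul_Gamma_div_Gamma (by omega),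
    show (k - 2 * k : ℝ) = -k by ring, rpow_neg hs.le, div_rpow hε.le hk1.le,
    div_rpow hk1.le two_pos.le, rpow_neg two_pos.le]
  have hε' := (rpow_pos_of_pos hε (k : ℝ)).ne'
  field_simp

/-- the Euclidean energy functional evaluated at the standard bubble equals
`E(U_{ε,a}) = (1/(2(n-1))) K_n^{-2(n-1)}`, independently of `ε` and `a`. -/
theorem bubble_energy_value (n : ℕ) (hn : 3 ≤ n) (ε : ℝ) (hε : 0 < ε)
    (a : EuclideanSpace ℝ (Fin (n - 1))) :
    (1 / 2) * (∫ y in {y : EuclideanSpace ℝ (Fin n) | 0 < lastCoord n y},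
        ‖gradient (bubble n ε a) y‖ ^ 2)
      - (((n : ℝ) - 2) / (2 * ((n : ℝ) - 1))) *
        ∫ x : EuclideanSpace ℝ (Fin (n - 1)),
          |bubble n ε a (emb n x 0)| ^ (2 * ((n : ℝ) - 1) / ((n : ℝ) - 2))
      = (1 / (2 * ((n : ℝ) - 1))) * Kconst n ^ (-(2 : ℝ) * ((n : ℝ) - 1)) := by
  obtain ⟨k, rfl⟩ : ∃ k, n = k + 1 := ⟨n - 1, by omega⟩
  change EuclideanSpace ℝ (Fin k) at a
  have hk : 2 ≤ k := by omega
  have hk' : (2 : ℝ) ≤ k := by exact_mod_cast hk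
  have h1 : ((k + 1 : ℕ) : ℝ) - 1 = k := by push_cast; ring
  have h2 : ((k + 1 : ℕ) : ℝ) - 2 = k - 1 := by push_cast; ring
  rw [Kconst_rpow_neg hn, h1, h2]
  refine (congrArg₂ (fun A B : ℝ => 1 / 2 * A - ((k : ℝ) - 1) / (2 * k) * B)
    (integral_sq_norm_gradient_bubble hk hε a) (integral_abs_bubble_rpow hk hε a)).trans ?_
  field_simp
  ring
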